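/- Strong duality on a finite scenario space: suppose Ω is a nonempty finite set, F is the power set of Ω, P({ω}) > 0 for every ω ∈ Ω, and there exists at least one admissible feasible drain process. Then the supremum of J(D) over admissible feasible drain processes equals the infimum of Φ(y) over dual feasible variables y, and both the supremum and the infimum are attained. -/

import Mathlib

open MeasureTheory Finset

noncomputable section

/-- Water level at time `t` induced by initial level `V1`, inflow `R` and drain `D`:
`V(t) = V(1) + ∑_{s=1}^{t-1} (R(s) - D(s))`. -/
def waterLevel {Ω : Type*} {N : ℕ} (V1 : Fin N → ℝ) (R D : ℕ → Ω → Fin N → ℝ)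
    (t : ℕ) (ω : Ω) (i : Fin N) : ℝ :=
  V1 i + ∑ s ∈ Finset.Ico 1 t, (R s ω i - D s ω i)

/-- Expected revenue `J(D) = E[∑_{t=1}^{T-1} D(t)·S(t+1) + α S(T)·V(T)]`. -/
def revenue {Ω : Type*} {N : ℕ} [MeasurableSpace Ω] (P : Measure Ω) (T : ℕ)
    (S R : ℕ → Ω → Fin N → ℝ) (V1 : Fin N → ℝ) (α : ℝ)
    (D : ℕ → Ω → Fin N → ℝ) : ℝ :=
  ∫ ω, (∑ t ∈ Finset.Ico 1 T, ∑ i, D t ω i * S (t + 1) ω i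
    + α * ∑ i, S T ω i * waterLevel V1 R D T ω i) ∂P

/-- A drain process is admissible if each `D(t)` is `G t`-measurable and bounded,
for `t = 1, …, T-1`. -/
def Admissible {Ω : Type*} {N : ℕ} (T : ℕ) (G : ℕ → MeasurableSpace Ω)
    (D : ℕ → Ω → Fin N → ℝ) : Prop :=
  ∀ t, 1 ≤ t → t ≤ T - 1 →
    Measurable[G t] (D t) ∧ ∃ C : ℝ, ∀ ω i, |D t ω i| ≤ C

/-- Feasibility: almost surely, `0 ≤ D(t) ≤ b` and `D(t) ≤ V(t) ≤ m`
componentwise for all `t = 1, …, T-1`. -/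
def FeasibleDrain {Ω : Type*} {N : ℕ} [MeasurableSpace Ω] (P : Measure Ω) (T : ℕ)
    (R : ℕ → Ω → Fin N → ℝ) (V1 b m : Fin N → ℝ)
    (D : ℕ → Ω → Fin N → ℝ) : Prop :=
  ∀ᵐ ω ∂P, ∀ t, 1 ≤ t → t ≤ T - 1 → ∀ i,
    0 ≤ D t ω i ∧ D t ω i ≤ b i ∧ D t ω i ≤ waterLevel V1 R D t ω i ∧
      waterLevel V1 R D t ω i ≤ m i

/-- A dual variable `y = (γ_t, v_t, λ_t, w_t)_{t=1}^{T-1}` consists of integrable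
maps `Ω → ℝ^N` which are almost surely nonnegative componentwise. -/
def IsDualVariable {Ω : Type*} {N : ℕ} [MeasurableSpace Ω] (P : Measure Ω) (T : ℕ)
    (gam v lam w : ℕ → Ω → Fin N → ℝ) : Prop :=
  (∀ t, 1 ≤ t → t ≤ T - 1 → ∀ i,
    Integrable (fun ω => gam t ω i) P ∧ Integrable (fun ω => v t ω i) P ∧
    Integrable (fun ω => lam t ω i) P ∧ Integrable (fun ω => w t ω i) P) ∧
  (∀ᵐ ω ∂P, ∀ t, 1 ≤ t → t ≤ T - 1 → ∀ i,
    0 ≤ gam t ω i ∧ 0 ≤ v t ω i ∧ 0 ≤ lam t ω i ∧ 0 ≤ w t ω i)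

/-- Dual feasibility: for every `t = 1, …, T-1` and every `A ∈ G_t`,
`∫_A (S(t+1) - α S(T) + γ_t - v_t - ∑_{s=t}^{T-1} λ_s + ∑_{s=t+1}^{T-1} w_s) dP = 0`. -/
def DualFeasible {Ω : Type*} {N : ℕ} [MeasurableSpace Ω] (P : Measure Ω) (T : ℕ)
    (G : ℕ → MeasurableSpace Ω) (S : ℕ → Ω → Fin N → ℝ) (α : ℝ)
    (gam v lam w : ℕ → Ω → Fin N → ℝ) : Prop :=
  ∀ t, 1 ≤ t → t ≤ T - 1 → ∀ A : Set Ω, MeasurableSet[G t] A → ∀ i,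
    ∫ ω in A, (S (t + 1) ω i - α * S T ω i + gam t ω i - v t ω i
      - ∑ s ∈ Finset.Icc t (T - 1), lam s ω i
      + ∑ s ∈ Finset.Icc (t + 1) (T - 1), w s ω i) ∂P = 0

/-- The dual value `Φ(y)`. -/
def dualValue {Ω : Type*} {N : ℕ} [MeasurableSpace Ω] (P : Measure Ω) (T : ℕ)
    (S R : ℕ → Ω → Fin N → ℝ) (V1 b m : Fin N → ℝ) (α : ℝ)
    (v lam w : ℕ → Ω → Fin N → ℝ) : ℝ :=
  α * ∫ ω, (∑ i, S T ω i * V1 i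
      + ∑ t ∈ Finset.Ico 1 T, ∑ i, S T ω i * R t ω i) ∂P
  + ∑ t ∈ Finset.Ico 1 T, ∫ ω,
      (∑ i, lam t ω i * (V1 i + ∑ s ∈ Finset.Ico 1 t, R s ω i)
       + ∑ i, v t ω i * b i
       + ∑ i, w t ω i * (m i - V1 i - ∑ s ∈ Finset.Ico 1 t, R s ω i)) ∂P

/-- The Farkas lemma, algebraic form. -/
theorem farkas_aux {E ι : Type*} [AddCommGroup E] [Module ℝ E] (s : Finset ι) :
    ∀ (f : ι → E →ₗ[ℝ] ℝ) (g : E →ₗ[ℝ] ℝ),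
      (∀ x, (∀ i ∈ s, 0 ≤ f i x) → 0 ≤ g x) →
      ∃ c : ι → ℝ, (∀ i, 0 ≤ c i) ∧ ∀ x, g x = ∑ i ∈ s, c i * f i x := by
  classical
  induction s using Finset.induction_on with
  | empty =>
    intro f g h
    refine ⟨fun _ => 0, fun _ => le_rfl, fun x => ?_⟩
    have h1 := h x (by simp)
    have h2 := h (-x) (by simp)
    rw [map_neg] at h2
    simp only [Finset.sum_empty]
    linarith
  | insert a s ha ih =>
    intro f g h
    by_cases hg : ∀ x, (∀ i ∈ s, 0 ≤ f i x) → 0 ≤ g x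
    · obtain ⟨c, hc, hgc⟩ := ih f g hg
      refine ⟨Function.update c a 0, fun i => ?_, fun x => ?_⟩
      · by_cases hi : i = a
        · subst hi; simp
        · simp [hi, hc i]
      · rw [Finset.sum_insert ha, hgc x]
        simp only [Function.update_self, zero_mul, zero_add]
        refine Finset.sum_congr rfl fun i hi => ?_
        have : i ≠ a := fun h' => ha (h' ▸ hi)
        simp [this]
    · push Not at hg
      obtain ⟨x1, hx1, hgx1⟩ := hg
      have hfa : f a x1 < 0 := by
        by_contra hcon
        push Not at hcon
        have := h x1 (by
          intro i hi
          rcases Finset.mem_insert.1 hi with rfl | hi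
          · exact hcon
          · exact hx1 i hi)
        linarith
      -- normalise
      set k : ℝ := (-(f a x1))⁻¹ with hk
      have hkpos : 0 < k := inv_pos.2 (by linarith)
      set x0 : E := k • x1 with hx0
      have hfa0 : f a x0 = -1 := by
        rw [hx0, map_smul, smul_eq_mul, hk]
        have : f a x1 ≠ 0 := ne_of_lt hfa
        field_simp
      have hfi0 : ∀ i ∈ s, 0 ≤ f i x0 := by
        intro i hi
        rw [hx0, map_smul, smul_eq_mul]
        exact mul_nonneg hkpos.le (hx1 i hi)
      have hg0 : g x0 < 0 := by
        rw [hx0, map_smul, smul_eq_mul]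
        exact mul_neg_of_pos_of_neg hkpos hgx1
      obtain ⟨c, hc, hgc⟩ := ih (fun i => f i + (f i x0) • f a) (g + (g x0) • f a) (by
        intro x hx
        have := h (x + f a x • x0) (by
          intro i hi
          rcases Finset.mem_insert.1 hi with rfl | hi
          · simp [hfa0]
          · have := hx i hi
            simp only [LinearMap.add_apply, LinearMap.smul_apply, smul_eq_mul] at this
            simp only [map_add, map_smul, smul_eq_mul]
            linarith)
        simp only [map_add, map_smul, smul_eq_mul] at this
        simp only [LinearMap.add_apply, LinearMap.smul_apply, smul_eq_mul]
        linarith)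
      have hnn : 0 ≤ ∑ i ∈ s, c i * f i x0 :=
        Finset.sum_nonneg fun i hi => mul_nonneg (hc i) (hfi0 i hi)
      refine ⟨Function.update c a (∑ i ∈ s, c i * f i x0 - g x0), fun i => ?_, fun x => ?_⟩
      · by_cases hi : i = a
        · subst hi
          simp only [Function.update_self]
          linarith
        · simp [hi, hc i]
      · rw [Finset.sum_insert ha]
        have e1 : ∑ i ∈ s, Function.update c a (∑ i ∈ s, c i * f i x0 - g x0) i * f i x
            = ∑ i ∈ s, c i * f i x := by
          refine Finset.sum_congr rfl fun i hi => ?_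
          have : i ≠ a := fun h' => ha (h' ▸ hi)
          simp [this]
        rw [e1]
        have := hgc x
        simp only [LinearMap.add_apply, LinearMap.smul_apply, smul_eq_mul, mul_add,
          Finset.sum_add_distrib] at this
        have e2 : ∑ i ∈ s, c i * (f i x0 * f a x) = (∑ i ∈ s, c i * f i x0) * f a x := by
          rw [Finset.sum_mul]
          exact Finset.sum_congr rfl fun i _ => by ring
        rw [e2] at this
        simp only [Function.update_self]
        linarith

/-- Affine Farkas lemma. -/
theorem farkas_affine {E ι : Type*} [AddCommGroup E] [Module ℝ E] (s : Finset ι)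
    (f : ι → E → ℝ) (g : E → ℝ)
    (hf : ∀ j ∈ s, IsLinearMap ℝ (fun x => f j x - f j 0))
    (hg : IsLinearMap ℝ (fun x => g x - g 0))
    (x0 : E) (hx0 : ∀ j ∈ s, 0 ≤ f j x0)
    (h : ∀ x, (∀ j ∈ s, 0 ≤ f j x) → 0 ≤ g x) :
    ∃ y : ι → ℝ, (∀ j, 0 ≤ y j) ∧ ∃ μ : ℝ, 0 ≤ μ ∧
      ∀ x, g x = ∑ j ∈ s, y j * f j x + μ := by
  classical
  let A : ι → E →ₗ[ℝ] ℝ := fun j => if hj : j ∈ s then (hf j hj).mk' _ else 0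
  have hA : ∀ j ∈ s, ∀ x, A j x = f j x - f j 0 := by
    intro j hj x
    simp [A, hj]
  let B : E →ₗ[ℝ] ℝ := hg.mk' _
  have hB : ∀ x, B x = g x - g 0 := fun x => rfl
  let F : Option ι → (E × ℝ) →ₗ[ℝ] ℝ := fun o => match o with
    | none => LinearMap.snd ℝ E ℝ
    | some j => (A j).comp (LinearMap.fst ℝ E ℝ) + (f j 0) • LinearMap.snd ℝ E ℝ
  have hF : ∀ j x t, F (some j) (x, t) = A j x + f j 0 * t := by
    intro j x t
    simp [F]
  have hF0 : ∀ x t, F none (x, t) = t := by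
    intro x t
    simp [F]
  obtain ⟨c, hc, hgc⟩ := farkas_aux (Finset.insertNone s) F
    (B.comp (LinearMap.fst ℝ E ℝ) + (g 0) • LinearMap.snd ℝ E ℝ) (by
      rintro ⟨x, t⟩ hx
      have ht : 0 ≤ t := by
        have := hx none (by simp)
        rwa [hF0] at this
      have hj : ∀ j ∈ s, 0 ≤ A j x + f j 0 * t := by
        intro j hj
        have := hx (some j) (by simpa using hj)
        rwa [hF] at this
      simp only [LinearMap.add_apply, LinearMap.comp_apply, LinearMap.fst_apply,
        LinearMap.smul_apply, LinearMap.snd_apply, smul_eq_mul]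
      rcases ht.eq_or_lt with rfl | ht
      · -- recession direction
        simp only [mul_zero, add_zero] at hj ⊢
        by_contra hneg
        push Not at hneg
        have key : ∀ r : ℝ, 0 ≤ r → 0 ≤ g x0 + r * B x := by
          intro r hr
          have := h (x0 + r • x) (by
            intro j hjs
            have h1 := hA j hjs (x0 + r • x)
            rw [map_add, map_smul, hA j hjs x0, smul_eq_mul] at h1
            have h2 := hx0 j hjs
            have h3 := mul_nonneg hr (hj j hjs)
            linarith)
          have h1 := hB (x0 + r • x)
          rw [map_add, map_smul, hB x0, smul_eq_mul] at h1
          linarith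
        have h0 := key 0 le_rfl
        have h1 := key ((g x0 + 1) / (-(B x))) (div_nonneg (by linarith) (by linarith))
        have h2 : (g x0 + 1) / (-(B x)) * B x = -(g x0 + 1) := by
          have : B x ≠ 0 := ne_of_lt hneg
          field_simp
        linarith
      · have := h (t⁻¹ • x) (by
          intro j hjs
          have h1 := hA j hjs (t⁻¹ • x)
          rw [map_smul, smul_eq_mul] at h1
          have h2 := mul_nonneg (inv_pos.2 ht).le (hj j hjs)
          have h3 : t⁻¹ * (A j x + f j 0 * t) = t⁻¹ * A j x + f j 0 := by
            field_simp
          linarith)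
        have h1 := hB (t⁻¹ • x)
        rw [map_smul, smul_eq_mul] at h1
        have h2 : 0 ≤ t⁻¹ * B x + g 0 := by linarith
        have h3 : B x + g 0 * t = t * (t⁻¹ * B x + g 0) := by field_simp
        rw [h3]
        exact mul_nonneg ht.le h2)
  refine ⟨fun j => c (some j), fun j => hc _, c none, hc _, fun x => ?_⟩
  have := hgc (x, 1)
  rw [Finset.sum_insertNone] at this
  simp only [LinearMap.add_apply, LinearMap.comp_apply, LinearMap.fst_apply,
        LinearMap.smul_apply, LinearMap.snd_apply, smul_eq_mul, hF, hF0, hB] at this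
  have e : ∑ j ∈ s, c (some j) * (A j x + f j 0 * 1) = ∑ j ∈ s, c (some j) * f j x := by
    refine Finset.sum_congr rfl fun j hj => ?_
    rw [hA j hj]; ring
  rw [e] at this
  linarith

/-- Pointwise Lagrangian identity. -/
theorem lagr_pointwise (T : ℕ) (hT : 1 ≤ T) (d s lam v w g r : ℕ → ℝ) (V b m α sT : ℝ) :
    α * (sT * V + ∑ t ∈ Finset.Ico 1 T, sT * r t)
      + ∑ t ∈ Finset.Ico 1 T, (lam t * (V + ∑ s ∈ Finset.Ico 1 t, r s) + v t * b
        + w t * (m - V - ∑ s ∈ Finset.Ico 1 t, r s))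
      - (∑ t ∈ Finset.Ico 1 T, d t * s (t + 1)
        + α * (sT * (V + ∑ s ∈ Finset.Ico 1 T, (r s - d s))))
    = ∑ t ∈ Finset.Ico 1 T, (g t * d t + v t * (b - d t)
        + lam t * (V + ∑ s ∈ Finset.Ico 1 t, (r s - d s) - d t)
        + w t * (m - (V + ∑ s ∈ Finset.Ico 1 t, (r s - d s))))
      - ∑ t ∈ Finset.Ico 1 T, d t * (s (t + 1) - α * sT + g t - v t
        - ∑ s ∈ Finset.Icc t (T - 1), lam s + ∑ s ∈ Finset.Icc (t + 1) (T - 1), w s) := by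
  have hI : ∀ t, Finset.Icc t (T - 1) = Finset.Ico t T := by
    intro t; ext x; simp only [Finset.mem_Icc, Finset.mem_Ico]; omega
  have swap : ∀ u : ℕ → ℝ, ∑ t ∈ Finset.Ico 1 T, d t * ∑ s ∈ Finset.Ico (t + 1) T, u s
      = ∑ t ∈ Finset.Ico 1 T, u t * ∑ s ∈ Finset.Ico 1 t, d s := by
    intro u
    simp only [Finset.mul_sum]
    rw [Finset.sum_Ico_Ico_comm']
    exact Finset.sum_congr rfl fun i _ => Finset.sum_congr rfl fun j _ => by ring
  have e1 : ∑ t ∈ Finset.Ico 1 T, d t * (s (t + 1) - α * sT + g t - v t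
        - ∑ s ∈ Finset.Icc t (T - 1), lam s + ∑ s ∈ Finset.Icc (t + 1) (T - 1), w s)
      = ∑ t ∈ Finset.Ico 1 T, (d t * (s (t + 1) - α * sT + g t - v t - lam t)
        - lam t * ∑ s ∈ Finset.Ico 1 t, d s + w t * ∑ s ∈ Finset.Ico 1 t, d s) := by
    rw [Finset.sum_add_distrib, Finset.sum_sub_distrib, ← swap lam, ← swap w,
      ← Finset.sum_sub_distrib, ← Finset.sum_add_distrib]
    refine Finset.sum_congr rfl fun t ht => ?_
    rw [hI, hI, Finset.sum_eq_sum_Ico_succ_bot (Finset.mem_Ico.1 ht).2]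
    ring
  rw [e1]
  have e2 : α * (sT * (V + ∑ s ∈ Finset.Ico 1 T, (r s - d s)))
      = α * (sT * V + ∑ t ∈ Finset.Ico 1 T, sT * r t) - ∑ t ∈ Finset.Ico 1 T, α * sT * d t := by
    rw [Finset.sum_sub_distrib, ← Finset.mul_sum, ← Finset.mul_sum]; ring
  rw [e2, ← Finset.sum_sub_distrib]
  have e3 : ∀ A B C D : ℝ, A + B - (C + (A - D)) = B - C + D := by intros; ring
  rw [e3, ← Finset.sum_sub_distrib, ← Finset.sum_add_distrib]
  refine Finset.sum_congr rfl fun t _ => ?_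
  simp only [Finset.sum_sub_distrib]
  ring

theorem fin_integral {Ω : Type*} {mΩ : MeasurableSpace Ω} [Fintype Ω]
    (hF : ∀ A : Set Ω, MeasurableSet A) (P : Measure Ω) [IsProbabilityMeasure P] (f : Ω → ℝ) :
    Integrable f P ∧ ∫ ω, f ω ∂P = ∑ ω, P.real {ω} * f ω := by
  have : MeasurableSingletonClass Ω := ⟨fun a => hF _⟩
  have h : Integrable f P := Integrable.of_finite
  exact ⟨h, by rw [integral_fintype h]; simp⟩

theorem fin_setIntegral {Ω : Type*} {mΩ : MeasurableSpace Ω} [Fintype Ω]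
    (hF : ∀ A : Set Ω, MeasurableSet A) (P : Measure Ω) [IsProbabilityMeasure P] (f : Ω → ℝ)
    (A : Set Ω) :
    ∫ ω in A, f ω ∂P = ∑ ω, P.real {ω} * A.indicator f ω := by
  rw [← integral_indicator (hF A), (fin_integral hF P _).2]

theorem fin_ae {Ω : Type*} {mΩ : MeasurableSpace Ω} (P : Measure Ω)
    (hP : ∀ ω : Ω, 0 < P {ω}) (q : Ω → Prop) : (∀ᵐ ω ∂P, q ω) ↔ ∀ ω, q ω := by
  constructor
  · intro h ω
    by_contra hq
    have h0 : P {ω | ¬ q ω} = 0 := h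
    have : P {ω} ≤ P {ω | ¬ q ω} := measure_mono (by simpa using hq)
    exact absurd (hP ω) (by rw [h0] at this; exact not_lt.2 this)
  · exact fun h => Filter.Eventually.of_forall h

/-- Integrand of the dual constraint. -/
def dualIntegrand {Ω : Type*} {N : ℕ} (T : ℕ) (S : ℕ → Ω → Fin N → ℝ) (α : ℝ)
    (gam v lam w : ℕ → Ω → Fin N → ℝ) (t : ℕ) (ω : Ω) (i : Fin N) : ℝ :=
  S (t + 1) ω i - α * S T ω i + gam t ω i - v t ω i
      - ∑ s ∈ Finset.Icc t (T - 1), lam s ω i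
      + ∑ s ∈ Finset.Icc (t + 1) (T - 1), w s ω i

theorem lagrangian {Ω : Type*} {mΩ : MeasurableSpace Ω} [Fintype Ω]
    (hF : ∀ A : Set Ω, MeasurableSet A) (P : Measure Ω) [IsProbabilityMeasure P]
    (T N : ℕ) (hT : 1 ≤ T) (S R : ℕ → Ω → Fin N → ℝ) (V1 b m : Fin N → ℝ) (α : ℝ)
    (D gam v lam w : ℕ → Ω → Fin N → ℝ) :
    dualValue P T S R V1 b m α v lam w - revenue P T S R V1 α D
    = ∑ t ∈ Finset.Ico 1 T, ∑ ω, ∑ i, P.real {ω} * (gam t ω i * D t ω i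
        + v t ω i * (b i - D t ω i) + lam t ω i * (waterLevel V1 R D t ω i - D t ω i)
        + w t ω i * (m i - waterLevel V1 R D t ω i))
      - ∑ t ∈ Finset.Ico 1 T, ∑ i, ∑ ω,
        P.real {ω} * (D t ω i * dualIntegrand T S α gam v lam w t ω i) := by
  have h1 : dualValue P T S R V1 b m α v lam w = ∑ ω, ∑ i, P.real {ω} *
      (α * (S T ω i * V1 i + ∑ t ∈ Finset.Ico 1 T, S T ω i * R t ω i)
      + ∑ t ∈ Finset.Ico 1 T, (lam t ω i * (V1 i + ∑ s ∈ Finset.Ico 1 t, R s ω i) + v t ω i * b i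
        + w t ω i * (m i - V1 i - ∑ s ∈ Finset.Ico 1 t, R s ω i))) := by
    unfold dualValue
    simp only [(fin_integral hF P _).2]
    rw [Finset.sum_comm, Finset.mul_sum, ← Finset.sum_add_distrib]
    refine Finset.sum_congr rfl fun ω _ => ?_
    simp only [← Finset.sum_add_distrib]
    rw [← Finset.mul_sum, Finset.sum_comm (s := Finset.Ico 1 T) (t := Finset.univ),
      Finset.sum_comm (s := Finset.Ico 1 T) (t := Finset.univ),
      ← Finset.sum_add_distrib, ← Finset.mul_sum, Finset.sum_add_distrib (f := fun i => α * _),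
      ← Finset.mul_sum]
    ring
  have h2 : revenue P T S R V1 α D = ∑ ω, ∑ i, P.real {ω} *
      (∑ t ∈ Finset.Ico 1 T, D t ω i * S (t + 1) ω i
        + α * (S T ω i * (V1 i + ∑ s ∈ Finset.Ico 1 T, (R s ω i - D s ω i)))) := by
    unfold revenue waterLevel
    simp only [(fin_integral hF P _).2]
    refine Finset.sum_congr rfl fun ω _ => ?_
    rw [Finset.sum_comm (s := Finset.Ico 1 T) (t := Finset.univ), Finset.mul_sum (a := α),
      ← Finset.sum_add_distrib, ← Finset.mul_sum]
  rw [h1, h2, ← Finset.sum_sub_distrib]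
  have h3 : ∀ f : ℕ → Fin N → Ω → ℝ, ∑ t ∈ Finset.Ico 1 T, ∑ i, ∑ ω, f t i ω
      = ∑ ω, ∑ i, ∑ t ∈ Finset.Ico 1 T, f t i ω := by
    intro f
    rw [Finset.sum_comm (s := Finset.Ico 1 T) (t := Finset.univ)]
    simp only [Finset.sum_comm (s := Finset.Ico 1 T) (t := Finset.univ)]
    rw [Finset.sum_comm]
  have h4 : ∀ f : ℕ → Ω → Fin N → ℝ, ∑ t ∈ Finset.Ico 1 T, ∑ ω, ∑ i, f t ω i
      = ∑ ω, ∑ i, ∑ t ∈ Finset.Ico 1 T, f t ω i := by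
    intro f
    rw [← h3 fun t i ω => f t ω i]
    exact Finset.sum_congr rfl fun t _ => Finset.sum_comm
  rw [h3, h4, ← Finset.sum_sub_distrib]
  refine Finset.sum_congr rfl fun ω _ => ?_
  rw [← Finset.sum_sub_distrib, ← Finset.sum_sub_distrib]
  refine Finset.sum_congr rfl fun i _ => ?_
  rw [← mul_sub, ← Finset.mul_sum (a := P.real {ω}), ← Finset.mul_sum (a := P.real {ω}), ← mul_sub]
  congr 1
  exact lagr_pointwise T hT (fun t => D t ω i) (fun t => S t ω i) (fun t => lam t ω i)
    (fun t => v t ω i) (fun t => w t ω i) (fun t => gam t ω i) (fun t => R t ω i)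
    (V1 i) (b i) (m i) α (S T ω i)

/-- Orthogonality to measurable functions. -/
theorem orth_of_sets {Ω : Type*} [Fintype Ω] (M : MeasurableSpace Ω) (p X d : Ω → ℝ)
    (hX : ∀ A : Set Ω, MeasurableSet[M] A → ∑ ω, p ω * A.indicator X ω = 0)
    (hd : Measurable[M] d) : ∑ ω, p ω * (d ω * X ω) = 0 := by
  classical
  rw [← Finset.sum_fiberwise_of_maps_to (s := Finset.univ) (t := Finset.univ.image d) (g := d)
    (fun ω _ => Finset.mem_image_of_mem d (Finset.mem_univ ω))]
  refine Finset.sum_eq_zero fun r _ => ?_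
  have h := hX (d ⁻¹' {r}) (hd (measurableSet_singleton r))
  have : ∑ ω with d ω = r, p ω * (d ω * X ω) = r * ∑ ω, p ω * (d ⁻¹' {r}).indicator X ω := by
    rw [Finset.sum_filter, Finset.mul_sum]
    refine Finset.sum_congr rfl fun ω _ => ?_
    by_cases hω : d ω = r
    · simp [Set.indicator, hω]; ring
    · simp [Set.indicator, hω]
  rw [this, h, mul_zero]

theorem waterLevel_congr {Ω : Type*} {N : ℕ} (V1 : Fin N → ℝ) (R D D' : ℕ → Ω → Fin N → ℝ)
    (T t : ℕ) (htT : t ≤ T) (h : ∀ s ∈ Finset.Ico 1 T, D s = D' s) (ω : Ω) (i : Fin N) :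
    waterLevel V1 R D t ω i = waterLevel V1 R D' t ω i := by
  unfold waterLevel
  congr 1
  refine Finset.sum_congr rfl fun s hs => ?_
  rw [h s (by simp only [Finset.mem_Ico] at hs ⊢; omega)]

theorem revenue_congr {Ω : Type*} {N : ℕ} [MeasurableSpace Ω] (P : Measure Ω) (T : ℕ)
    (S R : ℕ → Ω → Fin N → ℝ) (V1 : Fin N → ℝ) (α : ℝ)
    (D D' : ℕ → Ω → Fin N → ℝ) (h : ∀ s ∈ Finset.Ico 1 T, D s = D' s) :
    revenue P T S R V1 α D = revenue P T S R V1 α D' := by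
  unfold revenue
  congr 1
  funext ω
  congr 1
  · exact Finset.sum_congr rfl fun t ht => by rw [h t ht]
  · simp only [waterLevel_congr V1 R D D' T T le_rfl h]

/-- The four primal slack functions. -/
def slack {Ω : Type*} {N : ℕ} (R : ℕ → Ω → Fin N → ℝ) (V1 b m : Fin N → ℝ)
    (D : ℕ → Ω → Fin N → ℝ) (q : Fin 4) (t : ℕ) (ω : Ω) (i : Fin N) : ℝ :=
  ![D t ω i, b i - D t ω i, waterLevel V1 R D t ω i - D t ω i,
    m i - waterLevel V1 R D t ω i] q

/-- Pointwise version of feasibility. -/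
def PFeas {Ω : Type*} {N : ℕ} (T : ℕ) (G : ℕ → MeasurableSpace Ω)
    (R : ℕ → Ω → Fin N → ℝ) (V1 b m : Fin N → ℝ)
    (D : ℕ → Ω → Fin N → ℝ) : Prop :=
  (∀ t ∈ Finset.Ico 1 T, Measurable[G t] (D t)) ∧
  ∀ q, ∀ t ∈ Finset.Ico 1 T, ∀ ω i, 0 ≤ slack R V1 b m D q t ω i

theorem pfeas_iff {Ω : Type*} {mΩ : MeasurableSpace Ω} [Fintype Ω] {N : ℕ} (P : Measure Ω)
    (hP : ∀ ω : Ω, 0 < P {ω}) (T : ℕ) (G : ℕ → MeasurableSpace Ω)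
    (R : ℕ → Ω → Fin N → ℝ) (V1 b m : Fin N → ℝ)
    (D : ℕ → Ω → Fin N → ℝ) :
    (Admissible T G D ∧ FeasibleDrain P T R V1 b m D) ↔ PFeas T G R V1 b m D := by
  unfold Admissible FeasibleDrain PFeas
  rw [fin_ae P hP]
  constructor
  · rintro ⟨h1, h2⟩
    refine ⟨fun t ht => ?_, fun q t ht ω i => ?_⟩
    · rw [Finset.mem_Ico] at ht
      exact (h1 t ht.1 (by omega)).1
    · rw [Finset.mem_Ico] at ht
      obtain ⟨a1, a2, a3, a4⟩ := h2 ω t ht.1 (by omega) i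
      fin_cases q <;> simp [slack] <;> assumption
  · rintro ⟨h1, h2⟩
    refine ⟨fun t ht ht' => ⟨h1 t (by rw [Finset.mem_Ico]; omega), ?_⟩, fun ω t ht ht' i => ?_⟩
    · obtain ⟨C, hC⟩ := (Set.finite_range (fun x : Ω × Fin N => |D t x.1 x.2|)).bddAbove
      exact ⟨C, fun ω i => hC ⟨(ω, i), rfl⟩⟩
    · have ht2 : t ∈ Finset.Ico 1 T := by rw [Finset.mem_Ico]; omega
      have a0 := h2 0 t ht2 ω i
      have a1 := h2 1 t ht2 ω i
      have a2 := h2 2 t ht2 ω i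
      have a3 := h2 3 t ht2 ω i
      simp [slack] at a0 a1 a2 a3
      exact ⟨a0, a1, a2, a3⟩

theorem slack_congr {Ω : Type*} {N : ℕ} (R : ℕ → Ω → Fin N → ℝ) (V1 b m : Fin N → ℝ)
    (D D' : ℕ → Ω → Fin N → ℝ) (T : ℕ) (h : ∀ s ∈ Finset.Ico 1 T, D s = D' s) (q : Fin 4)
    (t : ℕ) (ht : t ∈ Finset.Ico 1 T) (ω : Ω) (i : Fin N) :
    slack R V1 b m D q t ω i = slack R V1 b m D' q t ω i := by
  unfold slack
  rw [waterLevel_congr V1 R D D' T t (Finset.mem_Ico.1 ht).2.le h, h t ht]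

theorem continuous_waterLevel {Ω : Type*} {N : ℕ} (R : ℕ → Ω → Fin N → ℝ) (V1 : Fin N → ℝ)
    (t : ℕ) (ω : Ω) (i : Fin N) :
    Continuous fun D : ℕ → Ω → Fin N → ℝ => waterLevel V1 R D t ω i := by
  unfold waterLevel
  fun_prop

theorem continuous_slack {Ω : Type*} {N : ℕ} (R : ℕ → Ω → Fin N → ℝ) (V1 b m : Fin N → ℝ)
    (q : Fin 4) (t : ℕ) (ω : Ω) (i : Fin N) :
    Continuous fun D : ℕ → Ω → Fin N → ℝ => slack R V1 b m D q t ω i := by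
  have := continuous_waterLevel R V1 t ω i
  fin_cases q <;> simp [slack] <;> fun_prop

theorem primal_attained {Ω : Type*} {mΩ : MeasurableSpace Ω} [Fintype Ω]
    (hF : ∀ A : Set Ω, MeasurableSet A) (P : Measure Ω) [IsProbabilityMeasure P]
    (T N : ℕ) (G : ℕ → MeasurableSpace Ω)
    (S R : ℕ → Ω → Fin N → ℝ) (V1 b m : Fin N → ℝ) (α : ℝ)
    (hfeas : ∃ D : ℕ → Ω → Fin N → ℝ, PFeas T G R V1 b m D) :
    ∃ D, PFeas T G R V1 b m D ∧ ∀ D', PFeas T G R V1 b m D' →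
      revenue P T S R V1 α D' ≤ revenue P T S R V1 α D := by
  classical
  let K : Set (ℕ → Ω → Fin N → ℝ) :=
    {D | PFeas T G R V1 b m D ∧ ∀ t, t ∉ Finset.Ico 1 T → D t = 0}
  let tr : (ℕ → Ω → Fin N → ℝ) → (ℕ → Ω → Fin N → ℝ) :=
    fun D t => if t ∈ Finset.Ico 1 T then D t else 0
  have htr : ∀ D, ∀ s ∈ Finset.Ico 1 T, tr D s = D s := by
    intro D s hs
    simp only [tr]
    rw [if_pos hs]
  have htrK : ∀ D, PFeas T G R V1 b m D → tr D ∈ K := by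
    rintro D ⟨h1, h2⟩
    refine ⟨⟨fun t ht => ?_, fun q t ht ω i => ?_⟩, fun t ht => ?_⟩
    · rw [htr D t ht]; exact h1 t ht
    · rw [slack_congr R V1 b m _ _ T (htr D) q t ht]
      exact h2 q t ht ω i
    · simp only [tr]
      rw [if_neg ht]
  have hcl : IsClosed K := by
    have e : K = (⋂ t ∈ Finset.Ico 1 T, {D | Measurable[G t] (D t)}) ∩
        (⋂ q, ⋂ t ∈ Finset.Ico 1 T, ⋂ ω, ⋂ i, {D | 0 ≤ slack R V1 b m D q t ω i}) ∩
        (⋂ t, ⋂ (_ : t ∉ Finset.Ico 1 T), {D | D t = 0}) := by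
      ext D
      simp only [K, PFeas, Set.mem_inter_iff, Set.mem_iInter, Set.mem_ofPred_eq]
    rw [e]
    refine ((isClosed_biInter fun t _ => ?_).inter (isClosed_iInter fun q =>
      isClosed_biInter fun t _ => isClosed_iInter fun ω => isClosed_iInter fun i => ?_)).inter
      (isClosed_iInter fun t => isClosed_iInter fun _ => ?_)
    · apply IsSeqClosed.isClosed
      intro u D hu hD
      exact @measurable_of_tendsto_metrizable Ω (Fin N → ℝ) (G t) _ _ _ _ (fun n => u n t) (D t)
        (fun n => hu n) ((continuous_apply t).continuousAt.tendsto.comp hD)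
    · exact isClosed_le continuous_const (continuous_slack R V1 b m q t ω i)
    · exact isClosed_eq (continuous_apply t) continuous_const
  have hK : IsCompact K := by
    refine (isCompact_Icc (a := (0 : ℕ → Ω → Fin N → ℝ))
      (b := fun _ _ i => |b i|)).of_isClosed_subset hcl ?_
    rintro D ⟨⟨_, h2⟩, h3⟩
    constructor
    · intro t ω i
      by_cases ht : t ∈ Finset.Ico 1 T
      · simpa [slack] using h2 0 t ht ω i
      · rw [h3 t ht]; simp
    · intro t ω i
      by_cases ht : t ∈ Finset.Ico 1 T
      · have := h2 1 t ht ω i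
        simp [slack] at this
        exact this.trans (le_abs_self _)
      · rw [h3 t ht]; simp
  have hcont : Continuous fun D => revenue P T S R V1 α D := by
    unfold revenue
    simp only [(fin_integral hF P _).2]
    have := fun ω i => continuous_waterLevel R V1 T ω i
    fun_prop
  obtain ⟨D0, hD0⟩ := hfeas
  obtain ⟨D, hDK, hmax⟩ := hK.exists_isMaxOn ⟨_, htrK D0 hD0⟩ hcont.continuousOn
  refine ⟨D, hDK.1, fun D' hD' => ?_⟩
  rw [← revenue_congr P T S R V1 α _ _ (htr D')]
  exact hmax (htrK D' hD')

theorem isLinear_waterLevel {Ω : Type*} {N : ℕ} (R : ℕ → Ω → Fin N → ℝ) (V1 : Fin N → ℝ)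
    (t : ℕ) (ω : Ω) (i : Fin N) (D : ℕ → Ω → Fin N → ℝ) :
    waterLevel V1 R D t ω i =
      waterLevel V1 R 0 t ω i - ∑ s ∈ Finset.Ico 1 t, D s ω i := by
  unfold waterLevel
  simp [Finset.sum_sub_distrib]
  ring

theorem isLinear_slack {Ω : Type*} {N : ℕ} (R : ℕ → Ω → Fin N → ℝ) (V1 b m : Fin N → ℝ)
    (q : Fin 4) (t : ℕ) (ω : Ω) (i : Fin N) :
    IsLinearMap ℝ fun D : ℕ → Ω → Fin N → ℝ =>
      slack R V1 b m D q t ω i - slack R V1 b m 0 q t ω i := by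
  constructor
  · intro D D'
    fin_cases q <;> simp [slack, isLinear_waterLevel R V1 t ω i (D + D'),
      isLinear_waterLevel R V1 t ω i D, isLinear_waterLevel R V1 t ω i D',
      Finset.sum_add_distrib] <;> ring
  · intro c D
    fin_cases q <;> simp [slack, isLinear_waterLevel R V1 t ω i (c • D),
      isLinear_waterLevel R V1 t ω i D, ← Finset.mul_sum] <;> ring

theorem isLinear_revenue {Ω : Type*} {mΩ : MeasurableSpace Ω} [Fintype Ω]
    (hF : ∀ A : Set Ω, MeasurableSet A) (P : Measure Ω) [IsProbabilityMeasure P]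
    (T N : ℕ) (S R : ℕ → Ω → Fin N → ℝ) (V1 : Fin N → ℝ) (α : ℝ) :
    IsLinearMap ℝ fun D : ℕ → Ω → Fin N → ℝ =>
      revenue P T S R V1 α D - revenue P T S R V1 α 0 := by
  have key : ∀ D : ℕ → Ω → Fin N → ℝ, revenue P T S R V1 α D - revenue P T S R V1 α 0
      = ∑ ω, P.real {ω} * (∑ t ∈ Finset.Ico 1 T, ∑ i, D t ω i * S (t + 1) ω i
        - α * ∑ i, S T ω i * ∑ s ∈ Finset.Ico 1 T, D s ω i) := by
    intro D
    unfold revenue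
    simp only [(fin_integral hF P _).2]
    rw [← Finset.sum_sub_distrib]
    refine Finset.sum_congr rfl fun ω _ => ?_
    simp only [isLinear_waterLevel R V1 T ω _ D, mul_sub, Finset.sum_sub_distrib]
    simp
    ring
  simp only [key]
  constructor
  · intro D D'
    rw [← Finset.sum_add_distrib]
    refine Finset.sum_congr rfl fun ω _ => ?_
    simp only [Pi.add_apply, add_mul, mul_add, Finset.sum_add_distrib]
    ring
  · intro c D
    simp only [Pi.smul_apply, smul_eq_mul]
    rw [Finset.mul_sum]
    refine Finset.sum_congr rfl fun ω _ => ?_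
    simp only [mul_assoc, ← Finset.mul_sum, mul_left_comm _ c]
    ring

/-- Drain processes that are adapted. -/
def adaptedSub {Ω : Type*} (N T : ℕ) (G : ℕ → MeasurableSpace Ω) :
    Submodule ℝ (ℕ → Ω → Fin N → ℝ) where
  carrier := {D | ∀ t ∈ Finset.Ico 1 T, Measurable[G t] (D t)}
  zero_mem' := fun t _ => @measurable_const _ _ _ (G t) _
  add_mem' := fun {a b} ha hb t ht => by
    have h1 := ha t ht
    have h2 := hb t ht
    exact Measurable.add h1 h2
  smul_mem' := fun c a ha t ht => Measurable.const_smul (ha t ht) c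

theorem mem_adaptedSub {Ω : Type*} (N T : ℕ) (G : ℕ → MeasurableSpace Ω)
    (D : ℕ → Ω → Fin N → ℝ) :
    D ∈ adaptedSub N T G ↔ ∀ t ∈ Finset.Ico 1 T, Measurable[G t] (D t) := Iff.rfl

theorem weak_duality {Ω : Type*} {mΩ : MeasurableSpace Ω} [Fintype Ω]
    (hF : ∀ A : Set Ω, MeasurableSet A) (P : Measure Ω) [IsProbabilityMeasure P]
    (hP : ∀ ω : Ω, 0 < P {ω})
    (T N : ℕ) (hT : 1 ≤ T) (G : ℕ → MeasurableSpace Ω)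
    (S R : ℕ → Ω → Fin N → ℝ) (V1 b m : Fin N → ℝ) (α : ℝ)
    (D gam v lam w : ℕ → Ω → Fin N → ℝ) (hD : PFeas T G R V1 b m D)
    (hy : IsDualVariable P T gam v lam w) (hyf : DualFeasible P T G S α gam v lam w) :
    revenue P T S R V1 α D ≤ dualValue P T S R V1 b m α v lam w := by
  have hl := lagrangian hF P T N hT S R V1 b m α D gam v lam w
  have h0 : ∑ t ∈ Finset.Ico 1 T, ∑ i, ∑ ω,
        P.real {ω} * (D t ω i * dualIntegrand T S α gam v lam w t ω i) = 0 := by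
    refine Finset.sum_eq_zero fun t ht => Finset.sum_eq_zero fun i _ => ?_
    refine orth_of_sets (G t) (fun ω => P.real {ω})
      (fun ω => dualIntegrand T S α gam v lam w t ω i) (fun ω => D t ω i) (fun A hA => ?_) ?_
    · rw [← fin_setIntegral hF P]
      rw [Finset.mem_Ico] at ht
      exact hyf t ht.1 (by omega) A hA i
    · exact (measurable_pi_apply i).comp (hD.1 t ht)
  have h1 : 0 ≤ ∑ t ∈ Finset.Ico 1 T, ∑ ω, ∑ i, P.real {ω} * (gam t ω i * D t ω i
        + v t ω i * (b i - D t ω i) + lam t ω i * (waterLevel V1 R D t ω i - D t ω i)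
        + w t ω i * (m i - waterLevel V1 R D t ω i)) := by
    refine Finset.sum_nonneg fun t ht => Finset.sum_nonneg fun ω _ =>
      Finset.sum_nonneg fun i _ => mul_nonneg measureReal_nonneg ?_
    have a0 := hD.2 0 t ht ω i
    have a1 := hD.2 1 t ht ω i
    have a2 := hD.2 2 t ht ω i
    have a3 := hD.2 3 t ht ω i
    rw [Finset.mem_Ico] at ht
    obtain ⟨c0, c1, c2, c3⟩ := (fin_ae P hP _).1 hy.2 ω t ht.1 (by omega) i
    exact add_nonneg (add_nonneg (add_nonneg (mul_nonneg c0 a0) (mul_nonneg c1 a1))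
      (mul_nonneg c2 a2)) (mul_nonneg c3 a3)
  linarith

theorem dual_attained {Ω : Type*} {mΩ : MeasurableSpace Ω} [Fintype Ω]
    (hF : ∀ A : Set Ω, MeasurableSet A) (P : Measure Ω) [IsProbabilityMeasure P]
    (hP : ∀ ω : Ω, 0 < P {ω})
    (T N : ℕ) (hT : 1 ≤ T) (G : ℕ → MeasurableSpace Ω)
    (S R : ℕ → Ω → Fin N → ℝ) (V1 b m : Fin N → ℝ) (α : ℝ)
    (D : ℕ → Ω → Fin N → ℝ) (hD : PFeas T G R V1 b m D)
    (hmax : ∀ D', PFeas T G R V1 b m D' →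
      revenue P T S R V1 α D' ≤ revenue P T S R V1 α D) :
    ∃ gam v lam w : ℕ → Ω → Fin N → ℝ, IsDualVariable P T gam v lam w ∧
      DualFeasible P T G S α gam v lam w ∧
      dualValue P T S R V1 b m α v lam w ≤ revenue P T S R V1 α D := by
  classical
  have hp : ∀ ω, 0 < P.real {ω} := fun ω =>
    ENNReal.toReal_pos (hP ω).ne' (measure_ne_top _ _)
  let E := adaptedSub (Ω := Ω) N T G
  let s : Finset (Fin 4 × ℕ × Ω × Fin N) :=
    Finset.univ ×ˢ (Finset.Ico 1 T ×ˢ (Finset.univ ×ˢ Finset.univ))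
  have hs : ∀ q t ω i, (q, t, ω, i) ∈ s ↔ t ∈ Finset.Ico 1 T := by
    intro q t ω i; simp [s]
  obtain ⟨y, hy, μ, hμ, hyeq⟩ := farkas_affine (E := E) s
    (fun j x => slack R V1 b m x.1 j.1 j.2.1 j.2.2.1 j.2.2.2)
    (fun x => revenue P T S R V1 α D - revenue P T S R V1 α x.1)
    (by
      rintro ⟨q, t, ω, i⟩ _
      have h := isLinear_slack R V1 b m q t ω i
      exact ⟨fun x z => h.map_add x.1 z.1, fun c x => h.map_smul c x.1⟩)
    (by
      have h := isLinear_revenue hF P T N S R V1 α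
      refine ⟨fun x z => ?_, fun c x => ?_⟩
      · have := h.map_add x.1 z.1
        simp only [Submodule.coe_add, Submodule.coe_zero] at this ⊢
        linarith
      · have := h.map_smul c x.1
        simp only [Submodule.coe_smul, Submodule.coe_zero, smul_eq_mul] at this ⊢
        linarith)
    ⟨D, (mem_adaptedSub N T G D).2 hD.1⟩
    (by
      rintro ⟨q, t, ω, i⟩ hj
      exact hD.2 q t ((hs q t ω i).1 hj) ω i)
    (by
      intro x hx
      have := hmax x.1 ⟨(mem_adaptedSub N T G x.1).1 x.2, fun q t ht ω i => hx (q, t, ω, i) ((hs q t ω i).2 ht)⟩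
      linarith)
  let z : Fin 4 → ℕ → Ω → Fin N → ℝ := fun q t ω i => y (q, t, ω, i) / P.real {ω}
  have hz : ∀ q t ω i, 0 ≤ z q t ω i := fun q t ω i => div_nonneg (hy _) (hp ω).le
  have hsum : ∀ x : E, ∑ j ∈ s, y j * slack R V1 b m x.1 j.1 j.2.1 j.2.2.1 j.2.2.2
      = ∑ t ∈ Finset.Ico 1 T, ∑ ω, ∑ i, P.real {ω} * (z 0 t ω i * x.1 t ω i
        + z 1 t ω i * (b i - x.1 t ω i) + z 2 t ω i * (waterLevel V1 R x.1 t ω i - x.1 t ω i)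
        + z 3 t ω i * (m i - waterLevel V1 R x.1 t ω i)) := by
    intro x
    simp only [s, Finset.sum_product, Fin.sum_univ_four, ← Finset.sum_add_distrib]
    refine Finset.sum_congr rfl fun t _ => Finset.sum_congr rfl fun ω _ =>
      Finset.sum_congr rfl fun i _ => ?_
    have := (hp ω).ne'
    simp [slack, z]
    field_simp
  have hident : ∀ x : E, dualValue P T S R V1 b m α (z 1) (z 2) (z 3) + μ
      - revenue P T S R V1 α D = - ∑ t ∈ Finset.Ico 1 T, ∑ i, ∑ ω,
        P.real {ω} * (x.1 t ω i * dualIntegrand T S α (z 0) (z 1) (z 2) (z 3) t ω i) := by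
    intro x
    have h1 := lagrangian hF P T N hT S R V1 b m α x.1 (z 0) (z 1) (z 2) (z 3)
    have h2 := hyeq x
    rw [hsum x] at h2
    linarith
  have h0 := hident 0
  simp only [Submodule.coe_zero, Pi.zero_apply, zero_mul, mul_zero, Finset.sum_const_zero,
    neg_zero] at h0
  refine ⟨z 0, z 1, z 2, z 3, ⟨fun t _ _ i => ?_, ?_⟩, ?_, by linarith⟩
  · exact ⟨(fin_integral hF P _).1, (fin_integral hF P _).1, (fin_integral hF P _).1,
      (fin_integral hF P _).1⟩
  · exact Filter.Eventually.of_forall fun ω t _ _ i => ⟨hz _ _ _ _, hz _ _ _ _, hz _ _ _ _,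
      hz _ _ _ _⟩
  · intro t ht ht' A hA i
    have htm : t ∈ Finset.Ico 1 T := by rw [Finset.mem_Ico]; omega
    let x : E := ⟨fun s ω j => if s = t ∧ j = i then A.indicator (fun _ => (1 : ℝ)) ω else 0, by
      refine (mem_adaptedSub N T G _).2 fun s _ => ?_
      refine @measurable_pi_lambda _ _ _ (G s) _ _ fun j => ?_
      by_cases h : s = t ∧ j = i
      · simp only [h]
        obtain ⟨rfl, rfl⟩ := h
        exact measurable_const.indicator hA
      · simp only [h]
        exact measurable_const⟩
    have hx := hident x
    rw [h0] at hx
    rw [fin_setIntegral hF P]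
    have e : ∑ s ∈ Finset.Ico 1 T, ∑ j, ∑ ω,
        P.real {ω} * (x.1 s ω j * dualIntegrand T S α (z 0) (z 1) (z 2) (z 3) s ω j)
        = ∑ ω, P.real {ω} * A.indicator
          (fun ω => dualIntegrand T S α (z 0) (z 1) (z 2) (z 3) t ω i) ω := by
      rw [Finset.sum_eq_single_of_mem t htm, Finset.sum_eq_single_of_mem i (Finset.mem_univ i)]
      · refine Finset.sum_congr rfl fun ω _ => ?_
        by_cases hω : ω ∈ A <;> simp [x, hω]
      · intro j _ hj
        simp [x, hj]
      · intro s _ hst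
        simp [x, hst]
    rw [e] at hx
    have hx' := neg_eq_zero.1 hx.symm
    exact hx'

/-- **Strong duality on a finite scenario space**: if `Ω` is a nonempty finite set,
`F` is the power set of `Ω`, `P({ω}) > 0` for every `ω`, and there exists at least
one admissible feasible drain process, then the supremum of `J(D)` over admissible
feasible drain processes equals the infimum of `Φ(y)` over dual feasible
variables, and both the supremum and the infimum are attained. -/
theorem strong_duality_finite {Ω : Type*} {mΩ : MeasurableSpace Ω}
    [Fintype Ω] [Nonempty Ω]
    (hF : ∀ A : Set Ω, MeasurableSet A)
    (P : Measure Ω) [IsProbabilityMeasure P]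
    (hP : ∀ ω : Ω, 0 < P {ω})
    (T N : ℕ) (hT : 2 ≤ T) (hN : 1 ≤ N)
    (G : ℕ → MeasurableSpace Ω)
    (hG_mono : ∀ s t, s ≤ t → G s ≤ G t) (hG_le : ∀ t, G t ≤ mΩ)
    (S R : ℕ → Ω → Fin N → ℝ)
    (hS_adapted : ∀ t, 1 ≤ t → t ≤ T → Measurable[G t] (S t))
    (hR_meas : ∀ t, Measurable (R t))
    (V1 b m : Fin N → ℝ) (α : ℝ)
    (hfeas : ∃ D : ℕ → Ω → Fin N → ℝ,
      Admissible T G D ∧ FeasibleDrain P T R V1 b m D) :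
    sSup {r : ℝ | ∃ D : ℕ → Ω → Fin N → ℝ,
        Admissible T G D ∧ FeasibleDrain P T R V1 b m D ∧
        revenue P T S R V1 α D = r}
      = sInf {r : ℝ | ∃ gam v lam w : ℕ → Ω → Fin N → ℝ,
          IsDualVariable P T gam v lam w ∧ DualFeasible P T G S α gam v lam w ∧
          dualValue P T S R V1 b m α v lam w = r} ∧
    (∃ D : ℕ → Ω → Fin N → ℝ,
      Admissible T G D ∧ FeasibleDrain P T R V1 b m D ∧
      revenue P T S R V1 α D
        = sSup {r : ℝ | ∃ D : ℕ → Ω → Fin N → ℝ,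
            Admissible T G D ∧ FeasibleDrain P T R V1 b m D ∧
            revenue P T S R V1 α D = r}) ∧
    ∃ gam v lam w : ℕ → Ω → Fin N → ℝ,
      IsDualVariable P T gam v lam w ∧ DualFeasible P T G S α gam v lam w ∧
      dualValue P T S R V1 b m α v lam w
        = sInf {r : ℝ | ∃ gam v lam w : ℕ → Ω → Fin N → ℝ,
            IsDualVariable P T gam v lam w ∧ DualFeasible P T G S α gam v lam w ∧
            dualValue P T S R V1 b m α v lam w = r} := by
  have hT1 : 1 ≤ T := by omega
  obtain ⟨D0, hD0⟩ := hfeas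
  obtain ⟨D, hD, hmax⟩ := primal_attained hF P T N G S R V1 b m α
    ⟨D0, (pfeas_iff P hP T G R V1 b m D0).1 hD0⟩
  obtain ⟨gam, v, lam, w, hy, hyf, hle⟩ :=
    dual_attained hF P hP T N hT1 G S R V1 b m α D hD hmax
  have hDaf := (pfeas_iff P hP T G R V1 b m D).2 hD
  have heq : dualValue P T S R V1 b m α v lam w = revenue P T S R V1 α D :=
    le_antisymm hle
      (weak_duality hF P hP T N hT1 G S R V1 b m α D gam v lam w hD hy hyf)
  have hsup : IsGreatest {r : ℝ | ∃ D : ℕ → Ω → Fin N → ℝ,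
        Admissible T G D ∧ FeasibleDrain P T R V1 b m D ∧
        revenue P T S R V1 α D = r} (revenue P T S R V1 α D) := by
    refine ⟨⟨D, hDaf.1, hDaf.2, rfl⟩, ?_⟩
    rintro r ⟨D', h1, h2, rfl⟩
    exact hmax D' ((pfeas_iff P hP T G R V1 b m D').1 ⟨h1, h2⟩)
  have hinf : IsLeast {r : ℝ | ∃ gam v lam w : ℕ → Ω → Fin N → ℝ,
          IsDualVariable P T gam v lam w ∧ DualFeasible P T G S α gam v lam w ∧
          dualValue P T S R V1 b m α v lam w = r} (revenue P T S R V1 α D) := by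
    refine ⟨⟨gam, v, lam, w, hy, hyf, heq⟩, ?_⟩
    rintro r ⟨gam', v', lam', w', h1, h2, rfl⟩
    exact weak_duality hF P hP T N hT1 G S R V1 b m α D gam' v' lam' w' hD h1 h2
  rw [hsup.csSup_eq, hinf.csInf_eq]
  exact ⟨rfl, ⟨D, hDaf.1, hDaf.2, rfl⟩, gam, v, lam, w, hy, hyf, heq⟩
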